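/- Let R be a semi-local regular integral domain of dimension 2 with 2 invertible, having exactly three maximal ideals m₁, m₂, m₃ with m₁ = (π₂, π₃), m₂ = (π₁, π₃), m₃ = (π₁, π₂), where each (π_i) is a prime ideal. Let K = Frac(R), a = π₂π₃, b = π₃π₁, c = π₁π₂π₃. Then the equation (X₁² − aY₁²)(X₂² − bY₂²)(X₃² − abY₃²) = c has no solution over K. -/

import Mathlib

namespace Stmt12

set_option linter.unusedSectionVars false

variable {R : Type*} [CommRing R] [IsDomain R] [IsNoetherianRing R]

/-- Nakayama's lemma in elementwise form. -/
lemma nak (Q N I : Ideal R) (h : Q ≤ N ⊔ I • Q) :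
    ∃ r : R, r - 1 ∈ I ∧ ∀ z ∈ Q, r * z ∈ N := by
  obtain ⟨r, hr, hrQ⟩ := Submodule.exists_sub_one_mem_and_smul_le_of_fg_of_le_sup
    (IsNoetherian.noetherian Q) le_rfl h
  exact ⟨r, hr, fun z hz => hrQ (Submodule.smul_mem_pointwise_smul z r Q hz)⟩

/-- A prime ideal containing `p` is `(p)` or maximal. -/
lemma prime_over {p : R} (hp : Prime p)
    (H : ∀ M : Ideal R, M.IsMaximal → p ∈ M → ∃ t, M = Ideal.span {p, t})
    (Q : Ideal R) (hQ : Q.IsPrime) (hpQ : p ∈ Q) : Q = Ideal.span {p} ∨ Q.IsMaximal := by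
  obtain ⟨M, hM, hQM⟩ := Ideal.exists_le_maximal Q hQ.ne_top
  obtain ⟨t, ht⟩ := H M hM (hQM hpQ)
  by_cases htQ : t ∈ Q
  · right
    have : Q = M := by
      apply le_antisymm hQM
      rw [ht, Ideal.span_le]
      rintro x (rfl | rfl) <;> assumption
    rwa [this]
  · left
    have htM : t ∈ M := by rw [ht]; exact Ideal.subset_span (by simp)
    apply le_antisymm
    · obtain ⟨r, hr, hrQ⟩ := nak Q (Ideal.span {p}) (Ideal.span {t}) (by
        intro z hz
        have hzM := hQM hz
        rw [ht, Ideal.mem_span_pair] at hzM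
        obtain ⟨α, β, rfl⟩ := hzM
        refine Submodule.add_mem_sup (Ideal.mem_span_singleton'.2 ⟨α, rfl⟩) ?_
        have h1 : β * t ∈ Q := by
          have := Q.sub_mem hz (Q.mul_mem_left α hpQ)
          simpa using this
        have hβ : β ∈ Q := (hQ.mem_or_mem h1).resolve_right htQ
        rw [mul_comm]
        exact Submodule.smul_mem_smul (Ideal.mem_span_singleton_self t) hβ)
      intro z hz
      have h1 := hrQ z hz
      rw [Ideal.mem_span_singleton] at h1 ⊢
      refine (hp.dvd_or_dvd h1).resolve_left ?_
      intro hpr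
      apply hM.ne_top
      rw [Ideal.eq_top_iff_one]
      have h2 : r ∈ M := by
        obtain ⟨k, rfl⟩ := hpr
        exact M.mul_mem_right _ (hQM hpQ)
      have h3 : r - 1 ∈ M := by
        rw [Ideal.mem_span_singleton] at hr
        obtain ⟨k, hk⟩ := hr
        rw [hk]; exact M.mul_mem_right _ htM
      simpa using M.sub_mem h2 h3
    · rw [Ideal.span_singleton_le_iff_mem]; exact hpQ

lemma quot_pid {p : R} (hp : Prime p)
    (H : ∀ M : Ideal R, M.IsMaximal → p ∈ M → ∃ t, M = Ideal.span {p, t}) :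
    IsPrincipalIdealRing (R ⧸ Ideal.span {p}) := by
  apply IsPrincipalIdealRing.of_prime
  intro q hq
  set π := Ideal.Quotient.mk (Ideal.span {p})
  have hpp : π p = 0 := Ideal.Quotient.eq_zero_iff_mem.2 (Ideal.mem_span_singleton_self p)
  have hmem : p ∈ q.comap π := by
    rw [Ideal.mem_comap, hpp]; exact q.zero_mem
  have hmap : (q.comap π).map π = q :=
    Ideal.map_comap_of_surjective π Ideal.Quotient.mk_surjective q
  rcases prime_over hp H (q.comap π) (Ideal.comap_isPrime π q) hmem with h | h
  · rw [h, Ideal.map_span] at hmap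
    exact ⟨⟨π p, by rw [← hmap]; simp⟩⟩
  · obtain ⟨t, ht⟩ := H _ h hmem
    rw [ht, Ideal.map_span, Set.image_pair, hpp] at hmap
    refine ⟨⟨π t, ?_⟩⟩
    rw [← hmap]
    simp

lemma local_gen {p : R} (hp : Prime p)
    (H : ∀ M : Ideal R, M.IsMaximal → p ∈ M → ∃ t, M = Ideal.span {p, t})
    (Q : Ideal R) (hQ : Q.IsPrime) (hpQ : p ∉ Q) :
    ∃ g ∈ Q, ∀ M : Ideal R, p ∈ M → Q ≤ Ideal.span {g} ⊔ M • Q := by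
  have := quot_pid hp H
  set π := Ideal.Quotient.mk (Ideal.span {p})
  obtain ⟨g', hg'⟩ := (IsPrincipalIdealRing.principal (Q.map π)).principal
  have h1 : g' ∈ Q.map π := by rw [hg']; exact Submodule.mem_span_singleton_self g'
  obtain ⟨g, hg, rfl⟩ := (Ideal.mem_map_iff_of_surjective π Ideal.Quotient.mk_surjective).1 h1
  refine ⟨g, hg, fun M hM z hz => ?_⟩
  have h2 : π z ∈ Q.map π := Ideal.mem_map_of_mem π hz
  rw [hg'] at h2
  obtain ⟨r', hr'⟩ := Submodule.mem_span_singleton.1 h2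
  obtain ⟨r, rfl⟩ := Ideal.Quotient.mk_surjective r'
  have h3 : π (r * g) = π z := by rw [map_mul]; exact hr'
  rw [eq_comm, Ideal.Quotient.eq, Ideal.mem_span_singleton] at h3
  obtain ⟨w, hw⟩ := h3
  have hz' : z = r * g + p * w := by rw [← hw]; ring
  have hpw : p * w ∈ Q := by rw [← hw]; exact Q.sub_mem hz (Q.mul_mem_left r hg)
  have hwQ := (hQ.mem_or_mem hpw).resolve_left hpQ
  rw [hz']
  exact Submodule.add_mem_sup (Ideal.mem_span_singleton'.2 ⟨r, rfl⟩)
    (Submodule.smul_mem_smul hM hwQ)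

lemma crt {m₁ m₂ m₃ : Ideal R} (hm₁ : m₁.IsMaximal) (hm₂ : m₂.IsMaximal) (hm₃ : m₃.IsMaximal)
    (hne₁₂ : m₁ ≠ m₂) (hne₁₃ : m₁ ≠ m₃) : ∃ e : R, e - 1 ∈ m₁ ∧ e ∈ m₂ ∧ e ∈ m₃ := by
  have h2 : (1 : R) ∈ m₁ ⊔ m₂ := by rw [hm₁.coprime_of_ne hm₂ hne₁₂]; trivial
  have h3 : (1 : R) ∈ m₁ ⊔ m₃ := by rw [hm₁.coprime_of_ne hm₃ hne₁₃]; trivial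
  obtain ⟨x, hx, y, hy, hxy⟩ := Submodule.mem_sup.1 h2
  obtain ⟨z, hz, w, hw, hzw⟩ := Submodule.mem_sup.1 h3
  refine ⟨y * w, ?_, m₂.mul_mem_right _ hy, m₃.mul_mem_left _ hw⟩
  have : y * w - 1 = -(x + y * z) := by linear_combination y * hzw + hxy
  rw [this]
  exact m₁.neg_mem (m₁.add_mem hx (m₁.mul_mem_left _ hz))

lemma transfer {Q M : Ideal R} {g g' : R} (h : Q ≤ Ideal.span {g'} ⊔ M • Q)
    (hgg : g' - g ∈ M • Q) : Q ≤ Ideal.span {g} ⊔ M • Q := by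
  refine h.trans (sup_le ?_ le_sup_right)
  rw [Ideal.span_singleton_le_iff_mem]
  have : g' = g + (g' - g) := by ring
  rw [this]
  exact Submodule.add_mem_sup (Ideal.mem_span_singleton_self g) hgg

lemma principal_of_local {m₁ m₂ m₃ : Ideal R}
    (hm₁ : m₁.IsMaximal) (hm₂ : m₂.IsMaximal) (hm₃ : m₃.IsMaximal)
    (hne₁₂ : m₁ ≠ m₂) (hne₁₃ : m₁ ≠ m₃) (hne₂₃ : m₂ ≠ m₃)
    (honly : ∀ m : Ideal R, m.IsMaximal → m = m₁ ∨ m = m₂ ∨ m = m₃)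
    (Q : Ideal R) (g₁ g₂ g₃ : R) (hg₁ : g₁ ∈ Q) (hg₂ : g₂ ∈ Q) (hg₃ : g₃ ∈ Q)
    (h₁ : Q ≤ Ideal.span {g₁} ⊔ m₁ • Q) (h₂ : Q ≤ Ideal.span {g₂} ⊔ m₂ • Q)
    (h₃ : Q ≤ Ideal.span {g₃} ⊔ m₃ • Q) : ∃ g, Q = Ideal.span {g} := by
  obtain ⟨e₁, a11, a12, a13⟩ := crt hm₁ hm₂ hm₃ hne₁₂ hne₁₃
  obtain ⟨e₂, a22, a21, a23⟩ := crt hm₂ hm₁ hm₃ hne₁₂.symm hne₂₃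
  obtain ⟨e₃, a33, a31, a32⟩ := crt hm₃ hm₁ hm₂ hne₁₃.symm hne₂₃.symm
  set g := e₁ * g₁ + e₂ * g₂ + e₃ * g₃ with hg
  have hgQ : g ∈ Q := Q.add_mem (Q.add_mem (Q.mul_mem_left _ hg₁) (Q.mul_mem_left _ hg₂))
    (Q.mul_mem_left _ hg₃)
  have key : ∀ (M : Ideal R) (c₁ c₂ c₃ : R), c₁ ∈ M → c₂ ∈ M → c₃ ∈ M →
      c₁ * g₁ + c₂ * g₂ + c₃ * g₃ ∈ M • Q := fun M c₁ c₂ c₃ k₁ k₂ k₃ =>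
    Submodule.add_mem _ (Submodule.add_mem _ (Submodule.smul_mem_smul k₁ hg₁)
      (Submodule.smul_mem_smul k₂ hg₂)) (Submodule.smul_mem_smul k₃ hg₃)
  have H₁ : Q ≤ Ideal.span {g} ⊔ m₁ • Q := transfer h₁ (by
    convert key m₁ (-(e₁ - 1)) (-e₂) (-e₃) (m₁.neg_mem a11) (m₁.neg_mem a21) (m₁.neg_mem a31)
      using 1
    rw [hg]; ring)
  have H₂ : Q ≤ Ideal.span {g} ⊔ m₂ • Q := transfer h₂ (by
    convert key m₂ (-e₁) (-(e₂ - 1)) (-e₃) (m₂.neg_mem a12) (m₂.neg_mem a22) (m₂.neg_mem a32)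
      using 1
    rw [hg]; ring)
  have H₃ : Q ≤ Ideal.span {g} ⊔ m₃ • Q := transfer h₃ (by
    convert key m₃ (-e₁) (-e₂) (-(e₃ - 1)) (m₃.neg_mem a13) (m₃.neg_mem a23) (m₃.neg_mem a33)
      using 1
    rw [hg]; ring)
  refine ⟨g, le_antisymm ?_ ((Ideal.span_singleton_le_iff_mem _).2 hgQ)⟩
  -- the conductor of `Q` into `(g)` is not contained in any maximal ideal
  by_contra hcon
  have hne : (Ideal.span {g}).colon (Q : Set R) ≠ ⊤ := by
    intro h
    apply hcon
    intro z hz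
    have : (1 : R) ∈ (Ideal.span {g}).colon (Q : Set R) := by rw [h]; trivial
    simpa using Submodule.mem_colon.1 this z hz
  obtain ⟨M, hM, hle⟩ := Ideal.exists_le_maximal _ hne
  have hMQ : Q ≤ Ideal.span {g} ⊔ M • Q := by
    rcases honly M hM with rfl | rfl | rfl <;> assumption
  obtain ⟨r, hr, hrQ⟩ := nak Q _ M hMQ
  have hrM : r ∈ M := hle (Submodule.mem_colon.2 fun z hz => hrQ z hz)
  apply hM.ne_top
  rw [Ideal.eq_top_iff_one]
  simpa using M.sub_mem hrM hr

/-- finite length of `R/(q,x)` from the description of the primes. -/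
lemma fin_len (hpr : ∀ Q : Ideal R, Q.IsPrime → Q.IsMaximal ∨ ∃ g, Q = Ideal.span {g})
    {q x : R} (hq : Prime q) (hx : ¬ q ∣ x) :
    Module.length R (R ⧸ Ideal.span {q, x}) ≠ ⊤ := by
  have : Ring.KrullDimLE 0 (R ⧸ Ideal.span {q, x}) := by
    apply Ring.KrullDimLE.mk₀
    intro I hI
    set π := Ideal.Quotient.mk (Ideal.span {q, x})
    have hle : Ideal.span {q, x} ≤ I.comap π := by
      intro z hz
      rw [Ideal.mem_comap, Ideal.Quotient.eq_zero_iff_mem.2 hz]; exact I.zero_mem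
    have hmax : (I.comap π).IsMaximal := by
      rcases hpr (I.comap π) (Ideal.comap_isPrime π I) with h | ⟨g, hg⟩
      · exact h
      · exfalso
        rw [hg] at hle
        have h1 : g ∣ q := Ideal.mem_span_singleton.1 (hle (Ideal.subset_span (by simp)))
        have h2 : g ∣ x := Ideal.mem_span_singleton.1 (hle (Ideal.subset_span (by simp)))
        have hgu : ¬ IsUnit g := by
          intro hu
          apply (Ideal.comap_isPrime π I).ne_top
          rw [hg]; exact Ideal.span_singleton_eq_top.2 hu
        exact hx (((hq.irreducible.dvd_iff.1 h1).resolve_left hgu).dvd.trans h2)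
    have hmap : (I.comap π).map π = I :=
      Ideal.map_comap_of_surjective π Ideal.Quotient.mk_surjective I
    rcases Ideal.map_eq_top_or_isMaximal_of_surjective π Ideal.Quotient.mk_surjective hmax
      with h | h
    · exact absurd (hmap ▸ h) hI.ne_top
    · rwa [hmap] at h
  have : IsArtinianRing (R ⧸ Ideal.span {q, x}) := IsNoetherianRing.isArtinianRing_of_krullDimLE_zero
  have h2 : IsArtinian R (R ⧸ Ideal.span {q, x}) :=
    isArtinian_of_surjective_algebraMap (R := R ⧸ Ideal.span {q, x})
      (by exact Ideal.Quotient.mk_surjective)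
  exact Module.length_ne_top

/-- parity of the length of `R/(q,x)` -/
noncomputable def L (q x : R) : ZMod 2 := ((Module.length R (R ⧸ Ideal.span {q, x})).toNat : ZMod 2)

lemma L_symm (q x : R) : L q x = L x q := by
  unfold L; rw [Set.pair_comm]

lemma L_congr {q x y : R} (h : q ∣ x - y) : L q x = L q y := by
  obtain ⟨k, hk⟩ := h
  have : Ideal.span {q, x} = Ideal.span {q, y} := by
    have hx : x = y + k * q := by linear_combination hk
    rw [hx]
    apply le_antisymm
    · rw [Ideal.span_le]
      rintro z (rfl | rfl)
      · exact Ideal.subset_span (by simp)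
      · exact Ideal.mem_span_pair.2 ⟨k, 1, by ring⟩
    · rw [Ideal.span_le]
      rintro z (rfl | rfl)
      · exact Ideal.subset_span (by simp)
      · exact Ideal.mem_span_pair.2 ⟨-k, 1, by ring⟩
  unfold L; rw [this]

lemma L_unit {q x : R} (hx : IsUnit x) : L q x = 0 := by
  have : Ideal.span {q, x} = ⊤ := Ideal.eq_top_of_isUnit_mem _ (Ideal.subset_span (by simp)) hx
  have : Subsingleton (R ⧸ Ideal.span {q, x}) := Ideal.Quotient.subsingleton_iff.2 this
  unfold L; rw [Module.length_eq_zero]; simp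

lemma L_max {q x : R} (h : (Ideal.span {q, x}).IsMaximal) : L q x = 1 := by
  have : IsSimpleModule R (R ⧸ Ideal.span {q, x}) :=
    isSimpleModule_iff_isCoatom.2 (Ideal.isMaximal_def.1 h)
  unfold L; rw [Module.length_eq_one]; simp

lemma length_mul {q x y : R} (hq : Prime q) (hy : ¬ q ∣ y) :
    Module.length R (R ⧸ Ideal.span {q, x * y}) =
      Module.length R (R ⧸ Ideal.span {q, x}) + Module.length R (R ⧸ Ideal.span {q, y}) := by
  have hf : Ideal.span {q, x} ≤ Submodule.comap (LinearMap.mulLeft R y) (Ideal.span {q, x * y}) := by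
    rw [Ideal.span_le]
    rintro z (rfl | rfl)
    · exact Ideal.mul_mem_left _ _ (Ideal.subset_span (by simp))
    · refine Ideal.subset_span ?_
      simp [mul_comm]
  have hg : Ideal.span {q, x * y} ≤ Ideal.span {q, y} := by
    rw [Ideal.span_le]
    rintro z (rfl | rfl)
    · exact Ideal.subset_span (by simp)
    · exact Ideal.mul_mem_left _ _ (Ideal.subset_span (by simp))
  refine Module.length_eq_add_of_exact
    (Submodule.mapQ (Ideal.span {q, x}) (Ideal.span {q, x * y}) (LinearMap.mulLeft R y) hf)
    (Submodule.factor hg) ?_ ?_ ?_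
  · rw [injective_iff_map_eq_zero]
    intro z hz
    obtain ⟨z, rfl⟩ := Submodule.Quotient.mk_surjective _ z
    rw [Submodule.mapQ_apply, Submodule.Quotient.mk_eq_zero, LinearMap.mulLeft_apply,
      Ideal.mem_span_pair] at hz
    obtain ⟨α, β, h⟩ := hz
    have h1 : q ∣ y * (z - β * x) := ⟨α, by linear_combination -h⟩
    obtain ⟨k, hk⟩ := (hq.dvd_or_dvd h1).resolve_left hy
    rw [Submodule.Quotient.mk_eq_zero, Ideal.mem_span_pair]
    exact ⟨k, β, by linear_combination -hk⟩
  · exact Submodule.factor_surjective hg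
  · intro z
    obtain ⟨z, rfl⟩ := Submodule.Quotient.mk_surjective _ z
    constructor
    · intro hz
      have hz : z ∈ Ideal.span {q, y} := (Submodule.Quotient.mk_eq_zero _).1 hz
      obtain ⟨α, β, h⟩ := Ideal.mem_span_pair.1 hz
      refine ⟨Submodule.Quotient.mk β, ?_⟩
      rw [Submodule.mapQ_apply, Submodule.Quotient.eq, LinearMap.mulLeft_apply,
        Ideal.mem_span_pair]
      exact ⟨-α, 0, by linear_combination -h⟩
    · rintro ⟨w, hw⟩
      obtain ⟨w, rfl⟩ := Submodule.Quotient.mk_surjective _ w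
      rw [← hw]
      refine (Submodule.Quotient.mk_eq_zero _).2 ?_
      exact Ideal.mul_mem_right _ _ (Ideal.subset_span (by simp))

def Fin' (R : Type*) [CommRing R] : Prop := ∀ q x : R, Prime q → ¬ q ∣ x →
  Module.length R (R ⧸ Ideal.span {q, x}) ≠ ⊤

lemma L_mul (hfin : Fin' R) {q x y : R} (hq : Prime q) (hx : ¬ q ∣ x) (hy : ¬ q ∣ y) :
    L q (x * y) = L q x + L q y := by
  unfold L
  rw [length_mul hq hy, ENat.toNat_add (hfin q x hq hx) (hfin q y hq hy)]
  push_cast; rfl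

lemma L_pow (hfin : Fin' R) {q x : R} (hq : Prime q) (hx : ¬ q ∣ x) (n : ℕ) :
    L q (x ^ n) = n * L q x := by
  induction n with
  | zero => simp [L_unit]
  | succ n ih =>
    rw [pow_succ, L_mul hfin hq (fun h => hx (hq.dvd_of_dvd_pow h)) hx, ih]
    push_cast; ring

lemma L_sq (hfin : Fin' R) {q x : R} (hq : Prime q) (hx : ¬ q ∣ x) : L q (x ^ 2) = 0 := by
  rw [L_pow hfin hq hx]
  have : ((2 : ℕ) : ZMod 2) = 0 := by decide
  rw [this, zero_mul]

lemma ndvd_mul {q x y : R} (hq : Prime q) (hx : ¬ q ∣ x) (hy : ¬ q ∣ y) : ¬ q ∣ x * y :=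
  fun h => (hq.dvd_or_dvd h).elim hx hy

lemma ndvd_pow {q x : R} (hq : Prime q) (hx : ¬ q ∣ x) (n : ℕ) : ¬ q ∣ x ^ n :=
  fun h => hx (hq.dvd_of_dvd_pow h)

lemma ndvd_prime {p q : R} (hp : Prime p) (hq : Prime q) (h : ¬ q ∣ p) : ¬ p ∣ q := by
  intro h'
  exact h ((hp.dvd_prime_iff_associated hq).1 h').symm.dvd

/-- key reciprocity input: if `b c` is a square mod `q` then `L b q + L c q = 0`. -/
lemma L_square (hfin : Fin' R) {q b c s t : R} (hq : Prime q) (hb : ¬ q ∣ b) (hc : ¬ q ∣ c)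
    (hs : ¬ q ∣ s) (h : q ∣ b * c * s ^ 2 - t ^ 2) : L b q + L c q = 0 := by
  have hs2 := ndvd_pow hq hs 2
  have hbc := ndvd_mul hq hb hc
  have ht : ¬ q ∣ t := by
    intro ht
    apply ndvd_mul hq hbc hs2
    have h1 : q ∣ t ^ 2 := dvd_pow ht (by norm_num)
    simpa using dvd_add h h1
  have h1 := L_congr h
  rw [L_mul hfin hq hbc hs2, L_mul hfin hq hb hc, L_sq hfin hq hs, L_sq hfin hq ht, add_zero] at h1
  rw [L_symm b, L_symm c, h1]

/-- odd valuation -/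
def OddAt (q F : R) : Prop := ∃ n F', Odd n ∧ ¬ q ∣ F' ∧ F = q ^ n * F'

lemma decomp_unique {q x y : R} (hq : Prime q) {m n : ℕ} (hx : ¬ q ∣ x) (hy : ¬ q ∣ y)
    (h : q ^ m * x = q ^ n * y) : m = n ∧ x = y := by
  wlog hmn : m ≤ n generalizing m n x y
  · have := this hy hx h.symm (by omega)
    exact ⟨this.1.symm, this.2.symm⟩
  obtain ⟨k, rfl⟩ := Nat.exists_eq_add_of_le hmn
  rw [pow_add, mul_assoc] at h
  have h1 := mul_left_cancel₀ (pow_ne_zero _ hq.ne_zero) h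
  cases k with
  | zero => simpa using h1
  | succ k => exact absurd ⟨q ^ k * y, by rw [h1]; ring⟩ hx

lemma decomp {q F : R} (hq : Prime q) (hF : F ≠ 0) : ∃ n F', ¬ q ∣ F' ∧ F = q ^ n * F' :=
  WfDvdMonoid.max_power_factor' hF hq.not_isUnit

lemma decomp_pair {q x y : R} (hq : Prime q) (h : ¬ (x = 0 ∧ y = 0)) :
    ∃ k x' y', x = q ^ k * x' ∧ y = q ^ k * y' ∧ ¬ (q ∣ x' ∧ q ∣ y') := by
  by_cases hx : x = 0
  · obtain ⟨n, y', h1, h2⟩ := decomp hq (fun hy => h ⟨hx, hy⟩)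
    exact ⟨n, 0, y', by simp [hx], h2, fun h => h1 h.2⟩
  by_cases hy : y = 0
  · obtain ⟨n, x', h1, h2⟩ := decomp hq hx
    exact ⟨n, x', 0, h2, by simp [hy], fun h => h1 h.1⟩
  obtain ⟨m, x', h1, h2⟩ := decomp hq hx
  obtain ⟨n, y', h3, h4⟩ := decomp hq hy
  rcases le_total m n with hmn | hmn
  · obtain ⟨k, rfl⟩ := Nat.exists_eq_add_of_le hmn
    exact ⟨m, x', q ^ k * y', h2, by rw [h4]; ring, fun h => h1 h.1⟩
  · obtain ⟨k, rfl⟩ := Nat.exists_eq_add_of_le hmn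
    exact ⟨n, q ^ k * x', y', by rw [h2]; ring, h4, fun h => h3 h.2⟩

lemma norm_odd {q a x y : R} (hq : Prime q) (h : OddAt q (x ^ 2 - a * y ^ 2)) :
    ∃ s t, ¬ q ∣ s ∧ q ∣ a * s ^ 2 - t ^ 2 := by
  obtain ⟨n, F', hn, hF', hF⟩ := h
  have h0 : ¬ (x = 0 ∧ y = 0) := by
    rintro ⟨rfl, rfl⟩
    apply hF'
    have : q ^ n * F' = 0 := by rw [← hF]; ring
    rw [(mul_eq_zero.1 this).resolve_left (pow_ne_zero _ hq.ne_zero)]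
    exact dvd_zero q
  obtain ⟨k, x', y', rfl, rfl, hxy⟩ := decomp_pair hq h0
  have h1 : q ^ (2 * k) * (x' ^ 2 - a * y' ^ 2) = q ^ n * F' := by rw [← hF]; ring
  have h2 : q ∣ x' ^ 2 - a * y' ^ 2 := by
    by_contra h2
    have := (decomp_unique hq h2 hF' h1).1
    obtain ⟨j, hj⟩ := hn
    omega
  refine ⟨y', x', ?_, by rw [← dvd_neg]; simpa using h2⟩
  intro hy
  refine hxy ⟨?_, hy⟩
  have h3 : q ∣ a * y' ^ 2 := Dvd.dvd.mul_left (dvd_pow hy (by norm_num)) a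
  exact hq.dvd_of_dvd_pow (by simpa using dvd_add h2 h3)

lemma norm_ram (hfin : Fin' R) {q a x y : R} (hq : Prime q) (ha : ¬ q ∣ a)
    (h : x ^ 2 - q * a * y ^ 2 ≠ 0) :
    ∃ (e : ℕ) (F' : R), x ^ 2 - q * a * y ^ 2 = q ^ e * F' ∧ ¬ q ∣ F' ∧ L q F' = e * L q a := by
  have h0 : ¬ (x = 0 ∧ y = 0) := by
    rintro ⟨rfl, rfl⟩
    apply h; ring
  obtain ⟨k, x', y', rfl, rfl, hxy⟩ := decomp_pair hq h0
  by_cases hx : q ∣ x'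
  · obtain ⟨z, rfl⟩ := hx
    have hy : ¬ q ∣ y' := fun hy => hxy ⟨⟨z, rfl⟩, hy⟩
    have hc : q ∣ (q * z ^ 2 - a * y' ^ 2) - (-1) * (a * y' ^ 2) := ⟨z ^ 2, by ring⟩
    have hu : IsUnit (-1 : R) := isUnit_one.neg
    have hu' : ¬ q ∣ -1 := fun h => hq.not_isUnit (isUnit_of_dvd_unit h hu)
    have hay := ndvd_mul hq ha (ndvd_pow hq hy 2)
    refine ⟨2 * k + 1, q * z ^ 2 - a * y' ^ 2, by ring, ?_, ?_⟩
    · intro h1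
      apply ndvd_mul hq hu' hay
      simpa using dvd_sub h1 hc
    · rw [L_congr hc, L_mul hfin hq hu' hay, L_unit hu, L_mul hfin hq ha (ndvd_pow hq hy 2),
        L_sq hfin hq hy]
      have : ((2 : ℕ) : ZMod 2) = 0 := by decide
      rw [Nat.cast_add, Nat.cast_mul, this]; simp
  · have hc : q ∣ (x' ^ 2 - q * a * y' ^ 2) - x' ^ 2 := ⟨-a * y' ^ 2, by ring⟩
    refine ⟨2 * k, x' ^ 2 - q * a * y' ^ 2, by ring, ?_, ?_⟩
    · intro h1
      apply ndvd_pow hq hx 2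
      simpa using dvd_sub h1 hc
    · rw [L_congr hc, L_sq hfin hq hx]
      have : ((2 : ℕ) : ZMod 2) = 0 := by decide
      rw [Nat.cast_mul, this]; simp

lemma two_mul_nat (n : ℕ) : (n : ZMod 2) + n = 0 := CharTwo.add_self_eq_zero _

lemma recip [UniqueFactorizationMonoid R] (hfin : Fin' R) {p₁ p₂ p₃ : R}
    (hp₁ : Prime p₁) (hp₂ : Prime p₂) (hp₃ : Prime p₃)
    (h12 : ¬ p₁ ∣ p₂) (h13 : ¬ p₁ ∣ p₃) (h31 : ¬ p₃ ∣ p₁) (h32 : ¬ p₃ ∣ p₂)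
    (l12 : L p₁ p₂ = 1) (l13 : L p₁ p₃ = 1) (l32 : L p₃ p₂ = 1) (F : R) :
    F ≠ 0 → (∀ q, Prime q → ¬ q ∣ p₁ → ¬ q ∣ p₂ → ¬ q ∣ p₃ → OddAt q F → L p₁ q + L p₃ q = 0) →
    ∃ (e₁ e₃ : ℕ) (F₁ F₃ : R), ¬ p₁ ∣ F₁ ∧ ¬ p₃ ∣ F₃ ∧ F = p₁ ^ e₁ * F₁ ∧ F = p₃ ^ e₃ * F₃ ∧
      L p₁ F₁ + L p₃ F₃ = e₁ + e₃ := by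
  have l31 : L p₃ p₁ = 1 := by rw [L_symm, l13]
  have nu : ∀ {p u : R}, Prime p → IsUnit u → ¬ p ∣ u := fun hp hu h =>
    hp.not_isUnit (isUnit_of_dvd_unit h hu)
  induction F using UniqueFactorizationMonoid.induction_on_coprime with
  | h0 => intro h; exact absurd rfl h
  | @h1 x hx =>
    intro _ _
    exact ⟨0, 0, x, x, nu hp₁ hx, nu hp₃ hx, by simp, by simp, by simp [L_unit hx]⟩
  | @hpr p i hp =>
    intro _ hodd
    by_cases c1 : p ∣ p₁
    · obtain ⟨u, rfl⟩ := ((hp.dvd_prime_iff_associated hp₁).1 c1).symm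
      have hu : IsUnit ((u : R) ^ i) := u.isUnit.pow i
      refine ⟨i, 0, (u : R) ^ i, (p₁ * u) ^ i, nu hp₁ hu, ?_, by ring, by simp, ?_⟩
      · exact ndvd_pow hp₃ (ndvd_mul hp₃ h31 (nu hp₃ u.isUnit)) i
      · rw [L_unit hu, L_pow hfin hp₃ (ndvd_mul hp₃ h31 (nu hp₃ u.isUnit)),
          L_mul hfin hp₃ h31 (nu hp₃ u.isUnit), L_unit u.isUnit, l31]; simp
    by_cases c3 : p ∣ p₃
    · obtain ⟨u, rfl⟩ := ((hp.dvd_prime_iff_associated hp₃).1 c3).symm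
      have hu : IsUnit ((u : R) ^ i) := u.isUnit.pow i
      refine ⟨0, i, (p₃ * u) ^ i, (u : R) ^ i, ?_, nu hp₃ hu, by simp, by ring, ?_⟩
      · exact ndvd_pow hp₁ (ndvd_mul hp₁ h13 (nu hp₁ u.isUnit)) i
      · rw [L_unit hu, L_pow hfin hp₁ (ndvd_mul hp₁ h13 (nu hp₁ u.isUnit)),
          L_mul hfin hp₁ h13 (nu hp₁ u.isUnit), L_unit u.isUnit, l13]; simp
    have d1 := ndvd_prime hp₁ hp c1
    have d3 := ndvd_prime hp₃ hp c3
    refine ⟨0, 0, p ^ i, p ^ i, ndvd_pow hp₁ d1 i, ndvd_pow hp₃ d3 i, by simp, by simp, ?_⟩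
    rw [L_pow hfin hp₁ d1, L_pow hfin hp₃ d3]
    by_cases c2 : p ∣ p₂
    · obtain ⟨u, rfl⟩ := ((hp.dvd_prime_iff_associated hp₂).1 c2).symm
      rw [L_mul hfin hp₃ h32 (nu hp₃ u.isUnit), L_unit u.isUnit, l32,
        L_mul hfin hp₁ h12 (nu hp₁ u.isUnit), L_unit u.isUnit, l12]
      simp [two_mul_nat]
    · rcases Nat.even_or_odd i with hi | hi
      · obtain ⟨j, rfl⟩ := hi
        simp [two_mul_nat]
      · have := hodd p hp c1 c2 c3 ⟨i, 1, hi, nu hp isUnit_one, by simp⟩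
        rw [← mul_add, this]; simp
  | @hcp x y hxy ihx ihy =>
    intro h0 hodd
    have key : ∀ {x y q : R}, IsRelPrime x y → Prime q → OddAt q x → y ≠ 0 → OddAt q (x * y) := by
      rintro x y q hxy hq ⟨n, x', hn, hx', rfl⟩ _
      refine ⟨n, x' * y, hn, ndvd_mul hq hx' ?_, by ring⟩
      intro hy
      refine hq.not_isUnit (hxy ?_ hy)
      exact Dvd.dvd.mul_right (dvd_pow_self q (by rintro rfl; simp at hn)) _
    have hx0 : x ≠ 0 := left_ne_zero_of_mul h0
    have hy0 : y ≠ 0 := right_ne_zero_of_mul h0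
    obtain ⟨a, b, X, X', hX, hX', e1, e2, e3⟩ := ihx hx0 (fun q hq c1 c2 c3 ho =>
      hodd q hq c1 c2 c3 (key hxy hq ho hy0))
    obtain ⟨c, d, Y, Y', hY, hY', f1, f2, f3⟩ := ihy hy0 (fun q hq c1 c2 c3 ho =>
      hodd q hq c1 c2 c3 (by rw [mul_comm]; exact key hxy.symm hq ho hx0))
    refine ⟨a + c, b + d, X * Y, X' * Y', ndvd_mul hp₁ hX hY, ndvd_mul hp₃ hX' hY', ?_, ?_, ?_⟩
    · rw [e1, f1]; ring
    · rw [e2, f2]; ring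
    · rw [L_mul hfin hp₁ hX hY, L_mul hfin hp₃ hX' hY']
      push_cast
      linear_combination e3 + f3

lemma nonsquare {p t r s w : R} (hp : Prime p) (hpt : ¬ p ∣ t)
    (hmax : (Ideal.span {p, t}).IsMaximal) (hr : r ∉ Ideal.span {p, t}) (hs : ¬ p ∣ s)
    (h : p ∣ t * r * s ^ 2 - w ^ 2) : False := by
  have hpi : (Ideal.span {p}).IsPrime := (Ideal.span_singleton_prime hp.ne_zero).2 hp
  set π := Ideal.Quotient.mk (Ideal.span {p}) with hπ
  have z : ∀ x, π x = 0 ↔ p ∣ x := fun x => by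
    rw [hπ, Ideal.Quotient.eq_zero_iff_mem, Ideal.mem_span_singleton]
  have ht0 : π t ≠ 0 := fun h => hpt ((z t).1 h)
  have hdvd : ∀ x, π t ∣ π x ↔ x ∈ Ideal.span {p, t} := by
    intro x
    rw [Ideal.mem_span_pair]
    constructor
    · rintro ⟨k, hk⟩
      obtain ⟨k, rfl⟩ := Ideal.Quotient.mk_surjective k
      have : π (x - t * k) = 0 := by rw [map_sub, map_mul, hk, sub_self]
      obtain ⟨l, hl⟩ := (z _).1 this
      exact ⟨l, k, by linear_combination -hl⟩
    · rintro ⟨α, β, rfl⟩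
      refine ⟨π β, ?_⟩
      rw [map_add, map_mul, map_mul, (z p).2 dvd_rfl]; ring
  have htp : Prime (π t) := by
    refine ⟨ht0, ?_, ?_⟩
    · intro hu
      have : π t ∣ π 1 := by rw [map_one]; exact hu.dvd
      exact hmax.ne_top ((Ideal.eq_top_iff_one _).2 ((hdvd 1).1 this))
    · intro x y hxy
      obtain ⟨x, rfl⟩ := Ideal.Quotient.mk_surjective x
      obtain ⟨y, rfl⟩ := Ideal.Quotient.mk_surjective y
      rw [← map_mul] at hxy
      exact (hmax.isPrime.mem_or_mem ((hdvd _).1 hxy)).imp (hdvd x).2 (hdvd y).2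
  have hr' : ¬ π t ∣ π r := fun h => hr ((hdvd r).1 h)
  have hr0 : π r ≠ 0 := fun h => hr' (by rw [h]; exact dvd_zero _)
  have hs0 : π s ≠ 0 := fun h => hs ((z s).1 h)
  have e : π t * π r * π s ^ 2 = π w ^ 2 := by
    rw [← map_mul, ← map_pow, ← map_mul, ← map_pow, ← sub_eq_zero, ← map_sub]
    exact (z _).2 h
  have hw0 : π w ≠ 0 := by
    intro hw
    rw [hw] at e
    have : π t * π r * π s ^ 2 ≠ 0 := mul_ne_zero (mul_ne_zero ht0 hr0) (pow_ne_zero _ hs0)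
    apply this; rw [e]; ring
  obtain ⟨m, s', hs', es⟩ := decomp htp hs0
  obtain ⟨n, w', hw', ew⟩ := decomp htp hw0
  have := (decomp_unique htp (m := 2 * m + 1) (n := 2 * n) (ndvd_mul htp hr' (ndvd_pow htp hs' 2))
    (ndvd_pow htp hw' 2) (by rw [es, ew] at e; linear_combination e)).1
  omega

lemma main [UniqueFactorizationMonoid R] (hfin : Fin' R) {p₁ p₂ p₃ : R}
    (hp₁ : Prime p₁) (hp₂ : Prime p₂) (hp₃ : Prime p₃)
    (h12 : ¬ p₁ ∣ p₂) (h13 : ¬ p₁ ∣ p₃) (h31 : ¬ p₃ ∣ p₁) (h32 : ¬ p₃ ∣ p₂)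
    (m1 : (Ideal.span {p₂, p₃}).IsMaximal) (m2 : (Ideal.span {p₁, p₃}).IsMaximal)
    (m3 : (Ideal.span {p₁, p₂}).IsMaximal) (hn : p₃ ∉ Ideal.span {p₁, p₂})
    (x₁ y₁ x₂ y₂ x₃ y₃ z : R) (hz : z ≠ 0)
    (h : (x₁ ^ 2 - p₂ * p₃ * y₁ ^ 2) * (x₂ ^ 2 - p₃ * p₁ * y₂ ^ 2) * (x₃ ^ 2 - p₁ * p₂ * y₃ ^ 2)
      = p₁ * p₂ * p₃ * z ^ 2) : False := by
  have l12 : L p₁ p₂ = 1 := L_max m3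
  have l13 : L p₁ p₃ = 1 := L_max m2
  have l32 : L p₃ p₂ = 1 := by rw [L_symm]; exact L_max m1
  have hne : p₁ * p₂ * p₃ * z ^ 2 ≠ 0 :=
    mul_ne_zero (mul_ne_zero (mul_ne_zero hp₁.ne_zero hp₂.ne_zero) hp₃.ne_zero)
      (pow_ne_zero _ hz)
  rw [← h] at hne
  have n1 : x₁ ^ 2 - p₂ * p₃ * y₁ ^ 2 ≠ 0 := left_ne_zero_of_mul (left_ne_zero_of_mul hne)
  have n2 : x₂ ^ 2 - p₃ * p₁ * y₂ ^ 2 ≠ 0 := right_ne_zero_of_mul (left_ne_zero_of_mul hne)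
  have n3 : x₃ ^ 2 - p₁ * p₂ * y₃ ^ 2 ≠ 0 := right_ne_zero_of_mul hne
  obtain ⟨e₁, e₃, F₁, F₃, hF₁, hF₃, E₁, E₃, hrec⟩ := recip hfin hp₁ hp₂ hp₃ h12 h13 h31 h32
    l12 l13 l32 (x₁ ^ 2 - p₂ * p₃ * y₁ ^ 2) n1 (by
      intro q hq c1 c2 c3 ho
      have hsq : ∃ s t, ¬ q ∣ s ∧ q ∣ p₁ * p₃ * s ^ 2 - t ^ 2 := by
        by_cases ho2 : OddAt q (x₂ ^ 2 - p₃ * p₁ * y₂ ^ 2)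
        · obtain ⟨s, t, hs, hd⟩ := norm_odd hq ho2
          exact ⟨s, t, hs, by rwa [mul_comm p₁ p₃]⟩
        · have ho3 : OddAt q (x₃ ^ 2 - p₁ * p₂ * y₃ ^ 2) := by
            obtain ⟨a, A, ha, hA, eA⟩ := ho
            obtain ⟨b, B, hB, eB⟩ := decomp hq n2
            obtain ⟨c, C, hC, eC⟩ := decomp hq n3
            obtain ⟨d, D, hD, eD⟩ := decomp hq hz
            have hb : ¬ Odd b := fun hb => ho2 ⟨b, B, hb, hB, eB⟩
            refine ⟨c, C, ?_, hC, eC⟩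
            rw [eA, eB, eC, eD] at h
            have := (decomp_unique hq (m := a + b + c) (n := 2 * d)
              (ndvd_mul hq (ndvd_mul hq hA hB) hC)
              (ndvd_mul hq (ndvd_mul hq (ndvd_mul hq c1 c2) c3) (ndvd_pow hq hD 2))
              (by linear_combination h)).1
            grind
          obtain ⟨s, t, hs, hd⟩ := norm_odd hq ho
          obtain ⟨s', t', hs', hd'⟩ := norm_odd hq ho3
          refine ⟨p₂ * s * s', t * t', ndvd_mul hq (ndvd_mul hq c2 hs) hs', ?_⟩
          obtain ⟨k, hk⟩ := hd
          obtain ⟨k', hk'⟩ := hd'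
          exact ⟨k * (p₁ * p₂ * s' ^ 2) + t ^ 2 * k', by
            linear_combination (p₁ * p₂ * s' ^ 2) * hk + t ^ 2 * hk'⟩
      obtain ⟨s, t, hs, hd⟩ := hsq
      exact L_square hfin hq c1 c3 hs hd)
  -- the residue at `p₃`
  have R3 : L p₃ F₃ = e₃ := by
    have e : x₁ ^ 2 - p₂ * p₃ * y₁ ^ 2 = x₁ ^ 2 - p₃ * p₂ * y₁ ^ 2 := by ring
    obtain ⟨e', F', h1, h2, h3⟩ := norm_ram hfin hp₃ h32 (e ▸ n1)
    rw [← e, E₃] at h1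
    obtain ⟨rfl, rfl⟩ := decomp_unique hp₃ hF₃ h2 h1
    rw [h3, l32, mul_one]
  -- the residue at `p₁`
  have V1 : Even e₁ := by
    by_contra hodd
    rw [Nat.not_even_iff_odd] at hodd
    obtain ⟨s, t, hs, hd⟩ := norm_odd hp₁ ⟨e₁, F₁, hodd, hF₁, E₁⟩
    exact nonsquare hp₁ h12 m3 hn hs hd
  have R1 : L p₁ F₁ = 1 := by
    have e : x₂ ^ 2 - p₃ * p₁ * y₂ ^ 2 = x₂ ^ 2 - p₁ * p₃ * y₂ ^ 2 := by ring
    obtain ⟨b, B, eB, hB, lB⟩ := norm_ram hfin hp₁ h13 (e ▸ n2)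
    obtain ⟨c, C, eC, hC, lC⟩ := norm_ram hfin hp₁ h12 n3
    obtain ⟨d, D, hD, eD⟩ := decomp hp₁ hz
    rw [e, E₁, eB, eC, eD] at h
    obtain ⟨u1, u2⟩ := decomp_unique hp₁ (m := e₁ + b + c) (n := 2 * d + 1)
      (ndvd_mul hp₁ (ndvd_mul hp₁ hF₁ hB) hC)
      (ndvd_mul hp₁ (ndvd_mul hp₁ h12 h13) (ndvd_pow hp₁ hD 2))
      (by linear_combination h)
    have u3 := congrArg (L p₁) u2
    rw [L_mul hfin hp₁ (ndvd_mul hp₁ hF₁ hB) hC, L_mul hfin hp₁ hF₁ hB, lB, lC, l13, l12,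
      L_mul hfin hp₁ (ndvd_mul hp₁ h12 h13) (ndvd_pow hp₁ hD 2), L_mul hfin hp₁ h12 h13,
      L_sq hfin hp₁ hD, l12, l13] at u3
    obtain ⟨j, rfl⟩ := V1
    have u4 := congrArg (Nat.cast : ℕ → ZMod 2) u1
    push_cast at u4
    have two : (2 : ZMod 2) = 0 := by decide
    linear_combination u3 - u4 + (j - d) * two
  obtain ⟨j, rfl⟩ := V1
  rw [R1, R3] at hrec
  push_cast at hrec
  rw [two_mul_nat] at hrec
  have : (1 : ZMod 2) = 0 := by linear_combination hrec
  exact absurd this (by decide)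

end Stmt12

lemma Stmt12.clear {R K : Type*} [CommRing R] [IsDomain R] [Field K] [Algebra R K]
    [IsFractionRing R K] (X Y : K) : ∃ x y d : R, d ≠ 0 ∧
      algebraMap R K x = algebraMap R K d * X ∧ algebraMap R K y = algebraMap R K d * Y := by
  obtain ⟨x, u, hu, rfl⟩ := IsFractionRing.div_surjective (A := R) X
  obtain ⟨y, v, hv, rfl⟩ := IsFractionRing.div_surjective (A := R) Y
  have hu0 : u ≠ 0 := nonZeroDivisors.ne_zero hu
  have hv0 : v ≠ 0 := nonZeroDivisors.ne_zero hv
  have hu' : algebraMap R K u ≠ 0 := by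
    rwa [Ne, IsFractionRing.to_map_eq_zero_iff]
  have hv' : algebraMap R K v ≠ 0 := by
    rwa [Ne, IsFractionRing.to_map_eq_zero_iff]
  refine ⟨x * v, y * u, u * v, mul_ne_zero hu0 hv0, ?_, ?_⟩
  · simp only [map_mul]; field_simp
  · simp only [map_mul]; field_simp

/-- Let `R` be a semi-local regular integral domain of dimension 2 with 2 invertible, having
exactly three maximal ideals `m₁, m₂, m₃` with `m₁ = (π₂, π₃)`, `m₂ = (π₁, π₃)`,
`m₃ = (π₁, π₂)`, where each `(πᵢ)` is a prime ideal. Let `K = Frac(R)`, `a = π₂π₃`,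
`b = π₃π₁`, `c = π₁π₂π₃`. Then the equation
`(X₁² − aY₁²)(X₂² − bY₂²)(X₃² − abY₃²) = c` has no solution over `K`. -/
theorem stmt_12 (R K : Type*) [CommRing R] [IsDomain R] [IsNoetherianRing R]
    [Field K] [Algebra R K] [IsFractionRing R K]
    (h2 : IsUnit (2 : R))
    (m₁ m₂ m₃ : Ideal R) (hm₁ : m₁.IsMaximal) (hm₂ : m₂.IsMaximal) (hm₃ : m₃.IsMaximal)
    (hne₁₂ : m₁ ≠ m₂) (hne₁₃ : m₁ ≠ m₃) (hne₂₃ : m₂ ≠ m₃)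
    (honly : ∀ m : Ideal R, m.IsMaximal → m = m₁ ∨ m = m₂ ∨ m = m₃)
    (π₁ π₂ π₃ : R) (hp₁ : Prime π₁) (hp₂ : Prime π₂) (hp₃ : Prime π₃)
    (hgen₁ : m₁ = Ideal.span {π₂, π₃})
    (hgen₂ : m₂ = Ideal.span {π₁, π₃})
    (hgen₃ : m₃ = Ideal.span {π₁, π₂}) :
    ¬ ∃ X1 Y1 X2 Y2 X3 Y3 : K,
        (X1 ^ 2 - algebraMap R K (π₂ * π₃) * Y1 ^ 2)
          * (X2 ^ 2 - algebraMap R K (π₃ * π₁) * Y2 ^ 2)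
          * (X3 ^ 2 - algebraMap R K (π₂ * π₃) * algebraMap R K (π₃ * π₁) * Y3 ^ 2)
        = algebraMap R K (π₁ * π₂ * π₃) := by
  rintro ⟨X1, Y1, X2, Y2, X3, Y3, h⟩
  subst hgen₁ hgen₂ hgen₃
  -- no `πᵢ` lies in `mᵢ`
  have k1 : π₁ ∉ Ideal.span {π₂, π₃} := by
    intro hmem
    refine hne₁₂ (hm₂.eq_of_le hm₁.ne_top ?_).symm
    rw [Ideal.span_le]
    rintro x (rfl | rfl)
    · exact hmem
    · exact Ideal.subset_span (by simp)
  have k2 : π₂ ∉ Ideal.span {π₁, π₃} := by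
    intro hmem
    refine hne₁₂ (hm₁.eq_of_le hm₂.ne_top ?_)
    rw [Ideal.span_le]
    rintro x (rfl | rfl)
    · exact hmem
    · exact Ideal.subset_span (by simp)
  have k3 : π₃ ∉ Ideal.span {π₁, π₂} := by
    intro hmem
    refine hne₁₃ (hm₁.eq_of_le hm₃.ne_top ?_)
    rw [Ideal.span_le]
    rintro x (rfl | rfl)
    · exact Ideal.subset_span (by simp)
    · exact hmem
  have nd : ∀ {p q x : R}, x ∉ Ideal.span {p, q} → ¬ p ∣ x := by
    rintro p q x hx ⟨k, rfl⟩
    exact hx (Ideal.mul_mem_right _ _ (Ideal.subset_span (by simp)))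
  have nd' : ∀ {p q x : R}, x ∉ Ideal.span {p, q} → ¬ q ∣ x := by
    rintro p q x hx ⟨k, rfl⟩
    exact hx (Ideal.mul_mem_right _ _ (Ideal.subset_span (by simp)))
  have H1 : ∀ M : Ideal R, M.IsMaximal → π₁ ∈ M → ∃ t, M = Ideal.span {π₁, t} := by
    intro M hM hmem
    rcases honly M hM with rfl | rfl | rfl
    · exact absurd hmem k1
    · exact ⟨π₃, rfl⟩
    · exact ⟨π₂, rfl⟩
  have H2 : ∀ M : Ideal R, M.IsMaximal → π₂ ∈ M → ∃ t, M = Ideal.span {π₂, t} := by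
    intro M hM hmem
    rcases honly M hM with rfl | rfl | rfl
    · exact ⟨π₃, rfl⟩
    · exact absurd hmem k2
    · exact ⟨π₁, by rw [Set.pair_comm]⟩
  have H3 : ∀ M : Ideal R, M.IsMaximal → π₃ ∈ M → ∃ t, M = Ideal.span {π₃, t} := by
    intro M hM hmem
    rcases honly M hM with rfl | rfl | rfl
    · exact ⟨π₂, by rw [Set.pair_comm]⟩
    · exact ⟨π₁, by rw [Set.pair_comm]⟩
    · exact absurd hmem k3
  have hpr : ∀ Q : Ideal R, Q.IsPrime → Q.IsMaximal ∨ ∃ g, Q = Ideal.span {g} := by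
    intro Q hQ
    by_cases c1 : π₁ ∈ Q
    · rcases Stmt12.prime_over hp₁ H1 Q hQ c1 with h | h
      · exact Or.inr ⟨_, h⟩
      · exact Or.inl h
    by_cases c2 : π₂ ∈ Q
    · rcases Stmt12.prime_over hp₂ H2 Q hQ c2 with h | h
      · exact Or.inr ⟨_, h⟩
      · exact Or.inl h
    right
    obtain ⟨g, hg, hgM⟩ := Stmt12.local_gen hp₁ H1 Q hQ c1
    obtain ⟨g', hg', hgM'⟩ := Stmt12.local_gen hp₂ H2 Q hQ c2
    exact Stmt12.principal_of_local hm₁ hm₂ hm₃ hne₁₂ hne₁₃ hne₂₃ honly Q g' g g hg' hg hg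
      (hgM' _ (Ideal.subset_span (by simp))) (hgM _ (Ideal.subset_span (by simp)))
      (hgM _ (Ideal.subset_span (by simp)))
  have hfin : Stmt12.Fin' R := fun q x hq hx => Stmt12.fin_len hpr hq hx
  have : UniqueFactorizationMonoid R := by
    rw [UniqueFactorizationMonoid.iff_exists_prime_mem_of_isPrime]
    intro I hI hIp
    rcases hpr I hIp with hmax | ⟨g, rfl⟩
    · rcases honly I hmax with rfl | rfl | rfl
      · exact ⟨π₂, Ideal.subset_span (by simp), hp₂⟩
      · exact ⟨π₁, Ideal.subset_span (by simp), hp₁⟩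
      · exact ⟨π₁, Ideal.subset_span (by simp), hp₁⟩
    · have hg0 : g ≠ 0 := by
        rintro rfl
        exact hI (by simp)
      exact ⟨g, Ideal.mem_span_singleton_self g, (Ideal.span_singleton_prime hg0).1 hIp⟩
  obtain ⟨x₁, y₁, d₁, hd₁, ex₁, ey₁⟩ := Stmt12.clear (R := R) X1 Y1
  obtain ⟨x₂, y₂, d₂, hd₂, ex₂, ey₂⟩ := Stmt12.clear (R := R) X2 Y2
  obtain ⟨x₃, y₃, d₃, hd₃, ex₃, ey₃⟩ := Stmt12.clear (R := R) X3 Y3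
  refine Stmt12.main hfin hp₁ hp₂ hp₃ (nd k2) (nd k3) (nd' k1) (nd' k2) hm₁ hm₂ hm₃ k3
    x₁ y₁ x₂ y₂ x₃ (π₃ * y₃) (d₁ * d₂ * d₃) (mul_ne_zero (mul_ne_zero hd₁ hd₂) hd₃) ?_
  apply IsFractionRing.injective R K
  simp only [map_mul, map_sub, map_pow] at h ⊢
  rw [ex₁, ey₁, ex₂, ey₂, ex₃, ey₃]
  linear_combination (algebraMap R K d₁ * algebraMap R K d₂ * algebraMap R K d₃) ^ 2 * h
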